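/- The map α : B → B defined by α(Σ_i a_i X^i) = Σ_i (−1)^i *^{i+1}(a_i) X^i is an involution of B = A[X;*]^fl extending the involution * of A; that is, α is K-linear, α(α(p)) = p and α(pq) = α(q)α(p) for all p, q ∈ B, and α(a) = a* for all a ∈ A. -/

import Mathlib

/-- `tau n a b = ab` if `n` is even and `ba` if `n` is odd. -/
def tau {A : Type*} [NonAssocRing A] (n : ℕ) (a b : A) : A :=
  if Even n then a * b else b * a

/-- The `m`-fold iterate `*^m` of the involution `*`. -/
def starIter {A : Type*} [NonAssocRing A] [StarRing A] : ℕ → A → A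
  | 0, a => a
  | m+1, a => star (starIter m a)

/-- The multiplication of the flipped non-associative skew polynomial ring `B = A[X;*]^fl`:
the biadditive extension of `(aX^m)(bX^n) = τ_n(a, *^m(b)) X^{m+n}`. Polynomials are
represented as finitely supported functions `ℕ →₀ A`. -/
noncomputable def fmul {A : Type*} [NonAssocRing A] [StarRing A] (p q : ℕ →₀ A) : ℕ →₀ A :=
  p.sum fun m a => q.sum fun n b => Finsupp.single (m+n) (tau n a (starIter m b))

/-- The map `α : B → B`, `α(Σ_i a_i X^i) = Σ_i (−1)^i *^{i+1}(a_i) X^i`. -/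
noncomputable def alphaMap {A : Type*} [NonAssocRing A] [StarRing A] (p : ℕ →₀ A) : ℕ →₀ A :=
  p.sum fun i a => Finsupp.single i ((-1 : ℤ) ^ i • starIter (i+1) a)

/-- The map `β : B → B`, `β(Σ_i a_i X^i) = Σ_i *^{i+1}(a_i) X^i`. -/
noncomputable def betaMap {A : Type*} [NonAssocRing A] [StarRing A] (p : ℕ →₀ A) : ℕ →₀ A :=
  p.sum fun i a => Finsupp.single i (starIter (i+1) a)

section SkewPolynomial

variable {A : Type*} [NonAssocRing A]

theorem tau_add_left (n : ℕ) (a b c : A) : tau n (a + b) c = tau n a c + tau n b c := by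
  simp only [tau, add_mul, mul_add]
  split_ifs <;> rfl

theorem tau_add_right (n : ℕ) (a b c : A) : tau n a (b + c) = tau n a b + tau n a c := by
  simp only [tau, add_mul, mul_add]
  split_ifs <;> rfl

theorem tau_zero_left (n : ℕ) (a : A) : tau n 0 a = 0 := by
  simp [tau]

theorem tau_zero_right (n : ℕ) (a : A) : tau n a 0 = 0 := by
  simp [tau]

theorem tau_zsmul_zsmul (n : ℕ) (j k : ℤ) (a b : A) :
    tau n (j • a) (k • b) = (j * k) • tau n a b := by
  simp only [tau, smul_mul_assoc, mul_smul_comm, smul_smul, mul_comm k j]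
  split_ifs <;> rfl

variable [StarRing A]

theorem starIter_eq_ite (m : ℕ) (a : A) : starIter m a = if Even m then a else star a := by
  induction m with
  | zero => simp [starIter]
  | succ m ih => by_cases h : Even m <;> simp [starIter, ih, h, Nat.even_add_one]

theorem starIter_zero_right (m : ℕ) : starIter m (0 : A) = 0 := by
  simp [starIter_eq_ite]

theorem starIter_add_right (m : ℕ) (a b : A) :
    starIter m (a + b) = starIter m a + starIter m b := by
  simp only [starIter_eq_ite, star_add]
  split_ifs <;> rfl

theorem starIter_zsmul (m : ℕ) (k : ℤ) (a : A) : starIter m (k • a) = k • starIter m a := by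
  simp only [starIter_eq_ite, star_zsmul]
  split_ifs <;> rfl

theorem starIter_starIter_self (m : ℕ) (a : A) : starIter m (starIter m a) = a := by
  simp only [starIter_eq_ite]
  split_ifs <;> simp

theorem starIter_tau (m n : ℕ) (a b : A) :
    starIter (m + n + 1) (tau n a (starIter m b)) =
      tau m (starIter (n + 1) b) (starIter n (starIter (m + 1) a)) := by
  by_cases hm : Even m <;> by_cases hn : Even n <;>
    simp [starIter_eq_ite, tau, hm, hn, Nat.even_add, Nat.even_add_one]

theorem alphaMap_zero : alphaMap (0 : ℕ →₀ A) = 0 := by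
  simp [alphaMap]

theorem alphaMap_single (i : ℕ) (a : A) :
    alphaMap (Finsupp.single i a) = Finsupp.single i ((-1 : ℤ) ^ i • starIter (i + 1) a) :=
  Finsupp.sum_single_index (by simp [starIter_zero_right])

theorem alphaMap_add (p q : ℕ →₀ A) : alphaMap (p + q) = alphaMap p + alphaMap q :=
  Finsupp.sum_add_index' (by simp [starIter_zero_right])
    (by simp [starIter_add_right, smul_add])

theorem zero_fmul (q : ℕ →₀ A) : fmul 0 q = 0 := by
  simp [fmul]

theorem fmul_zero (p : ℕ →₀ A) : fmul p 0 = 0 := by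
  simp [fmul]

theorem add_fmul (p q r : ℕ →₀ A) : fmul (p + q) r = fmul p r + fmul q r :=
  Finsupp.sum_add_index' (by simp [tau_zero_left])
    (by simp [tau_add_left, Finsupp.sum_add])

theorem fmul_add (p q r : ℕ →₀ A) : fmul p (q + r) = fmul p q + fmul p r := by
  simp only [fmul]
  rw [← Finsupp.sum_add]
  congr! 3 with m a
  exact Finsupp.sum_add_index' (by simp [starIter_zero_right, tau_zero_right])
    (by simp [starIter_add_right, tau_add_right])

theorem fmul_single_single (m n : ℕ) (a b : A) :
    fmul (Finsupp.single m a) (Finsupp.single n b) =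
      Finsupp.single (m + n) (tau n a (starIter m b)) := by
  rw [fmul, Finsupp.sum_single_index (by simp [tau_zero_left]),
    Finsupp.sum_single_index (by simp [starIter_zero_right, tau_zero_right])]

theorem alphaMap_alphaMap (p : ℕ →₀ A) : alphaMap (alphaMap p) = p := by
  induction p using Finsupp.induction_linear with
  | zero => simp [alphaMap_zero]
  | add p q hp hq => rw [alphaMap_add, alphaMap_add, hp, hq]
  | single i a =>
    rw [alphaMap_single, alphaMap_single, starIter_zsmul, starIter_starIter_self, smul_smul,
      ← mul_pow]
    simp

theorem alphaMap_fmul (p q : ℕ →₀ A) :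
    alphaMap (fmul p q) = fmul (alphaMap q) (alphaMap p) := by
  induction p using Finsupp.induction_linear with
  | zero => simp [zero_fmul, fmul_zero, alphaMap_zero]
  | add p p' hp hp' => rw [add_fmul, alphaMap_add, alphaMap_add, fmul_add, hp, hp']
  | single m a =>
    induction q using Finsupp.induction_linear with
    | zero => simp [zero_fmul, fmul_zero, alphaMap_zero]
    | add q q' hq hq' => rw [fmul_add, alphaMap_add, alphaMap_add, add_fmul, hq, hq']
    | single n b =>
      rw [fmul_single_single, alphaMap_single, alphaMap_single, alphaMap_single,
        fmul_single_single, starIter_zsmul, tau_zsmul_zsmul, starIter_tau, ← pow_add,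
        add_comm n m]

theorem starIter_smul {K : Type*} [CommRing K] [Module K A]
    (hstar : ∀ (k : K) (a : A), star (k • a) = k • star a) (m : ℕ) (k : K) (a : A) :
    starIter m (k • a) = k • starIter m a := by
  simp only [starIter_eq_ite, hstar]
  split_ifs <;> rfl

theorem alphaMap_smul {K : Type*} [CommRing K] [Module K A]
    (hstar : ∀ (k : K) (a : A), star (k • a) = k • star a) (k : K) (p : ℕ →₀ A) :
    alphaMap (k • p) = k • alphaMap p := by
  induction p using Finsupp.induction_linear with
  | zero => simp [alphaMap_zero]
  | add p q hp hq => rw [smul_add, alphaMap_add, alphaMap_add, hp, hq, smul_add]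
  | single i a =>
    rw [Finsupp.smul_single, alphaMap_single, alphaMap_single, Finsupp.smul_single,
      starIter_smul hstar, smul_comm]

end SkewPolynomial

/-- `α` is an involution of `B = A[X;*]^fl` extending the involution `*` of `A`:
it is `K`-linear, satisfies `α∘α = id` and `α(pq) = α(q)α(p)`, and restricts to `*` on `A`. -/
theorem alphaMap_is_involution {K A : Type*} [CommRing K] [NonAssocRing A] [Module K A]
    [SMulCommClass K A A] [IsScalarTower K A A] [StarRing A]
    (hstar : ∀ (k : K) (a : A), star (k • a) = k • star a) :
    (∀ p q : ℕ →₀ A, alphaMap (p + q) = alphaMap p + alphaMap q) ∧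
    (∀ (k : K) (p : ℕ →₀ A), alphaMap (k • p) = k • alphaMap p) ∧
    (∀ p : ℕ →₀ A, alphaMap (alphaMap p) = p) ∧
    (∀ p q : ℕ →₀ A, alphaMap (fmul p q) = fmul (alphaMap q) (alphaMap p)) ∧
    (∀ a : A, alphaMap (Finsupp.single 0 a) = Finsupp.single 0 (star a)) := by
  refine ⟨alphaMap_add, alphaMap_smul hstar, alphaMap_alphaMap, alphaMap_fmul, fun a => ?_⟩
  simp [alphaMap_single, starIter]
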